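/- arXiv:2401.14894 — 3 statements merged into one kernel-verified Lean document; each statement's English description precedes it below -/
import Mathlib

section
/- Let p ∈ [1, ∞). Let (x_n)_{n∈ℕ} be a sequence of nonnegative reals with (x_n) ∈ ℓ^p(ℕ), and for each ℓ ∈ ℕ₀ let (x_n^{(ℓ)})_{n∈ℕ} be a sequence of nonnegative reals in ℓ^p(ℕ) such that ‖(x_n − x_n^{(ℓ)})_n‖_{ℓ^p(ℕ)} → 0 as ℓ → ∞. Let g : [0,∞) → [0,∞) be continuous with g(0) = 0, and let (P_ℓ)_{ℓ∈ℕ₀} be a sequence of subsets of ℕ that is nested, i.e., P_ℓ ⊆ P_{ℓ+1} for all ℓ ∈ ℕ₀, and satisfies: for all ℓ ∈ ℕ₀ and all m ∈ ℕ \ P_{ℓ+1}, x_m^{(ℓ)} ≤ g( Σ_{n ∈ P_{ℓ+1} \ P_ℓ} (x_n^{(ℓ)})^p ). Then Σ_{n ∈ ℕ \ P_ℓ} x_n^p → 0 as ℓ → ∞. -/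
open Filter Topology

/-- Tails of a convergent nonnegative series over sets that eventually leave every index with a
nonzero term tend to zero. -/
theorem tendsto_tsum_subtype_of_eventually_notMem {f : ℕ → ℝ} (hf : Summable f)
    (hf0 : ∀ n, 0 ≤ f n) (s : ℕ → Set ℕ) (hs : ∀ n, f n ≠ 0 → ∀ᶠ l in atTop, n ∉ s l) :
    Tendsto (fun l => ∑' n : ↥(s l), f n) atTop (𝓝 0) := by
  rw [funext fun l => tsum_subtype (s l) f, ← tsum_zero (α := ℝ) (β := ℕ) (L := .unconditional ℕ)]
  refine tendsto_tsum_of_dominated_convergence hf (fun n => ?_) (.of_forall fun l n => ?_)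
  · by_cases hn : f n = 0
    · refine tendsto_const_nhds.congr fun l => ?_
      by_cases hl : n ∈ s l <;> simp [hl, hn]
    · exact tendsto_const_nhds.congr' <| (hs n hn).mono fun l hl => by simp [hl]
  · rw [Real.norm_of_nonneg (Set.indicator_nonneg (fun n _ => hf0 n) n)]
    exact Set.indicator_le_self' (fun n _ => hf0 n) n

/-- Abstract ℓ^p-sequence lemma used to prove convergence of parametric error
estimates under Dörfler-type marking. -/
theorem abstract_lp_convergence_lemma
    (p : ℝ) (hp : 1 ≤ p)
    (x : ℕ → ℝ) (hx : ∀ n, 0 ≤ x n)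
    (hxp : Summable fun n => x n ^ p)
    (xl : ℕ → ℕ → ℝ) (hxl : ∀ l n, 0 ≤ xl l n)
    (hxlp : ∀ l, Summable fun n => xl l n ^ p)
    (hdiffp : ∀ l, Summable fun n => |x n - xl l n| ^ p)
    (hconv : Filter.Tendsto (fun l => (∑' n, |x n - xl l n| ^ p) ^ (1 / p))
      Filter.atTop (nhds 0))
    (g : ℝ → ℝ) (hg : ContinuousOn g (Set.Ici 0)) (hg0 : g 0 = 0)
    (hgnonneg : ∀ s, 0 ≤ s → 0 ≤ g s)
    (P : ℕ → Set ℕ) (hP : ∀ l, P l ⊆ P (l + 1))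
    (hmark : ∀ l, ∀ m ∉ P (l + 1),
      xl l m ≤ g (∑' n : ↥(P (l + 1) \ P l), xl l (n : ℕ) ^ p)) :
    Filter.Tendsto (fun l => ∑' n : ↥((P l)ᶜ), x (n : ℕ) ^ p)
      Filter.atTop (nhds 0) := by
  have hp0 : 0 < p := by linarith
  have hd0 : ∀ l n, 0 ≤ |x n - xl l n| ^ p := fun l n => by positivity
  have hmono : Monotone P := monotone_nat_of_le_succ hP
  have hD : Tendsto (fun l => ∑' n, |x n - xl l n| ^ p) atTop (𝓝 0) := by
    have h := hconv.rpow_const (p := p) (Or.inr hp0.le)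
    rw [Real.zero_rpow hp0.ne'] at h
    refine h.congr fun l => ?_
    rw [one_div, Real.rpow_inv_rpow (tsum_nonneg (hd0 l)) hp0.ne']
  have hpt : ∀ n, Tendsto (fun l => xl l n) atTop (𝓝 (x n)) := fun n => by
    rw [tendsto_iff_norm_sub_tendsto_zero]
    refine squeeze_zero (fun _ => norm_nonneg _) (fun l => ?_) hconv
    rw [Real.norm_eq_abs, abs_sub_comm, ← Real.rpow_rpow_inv (abs_nonneg (x n - xl l n)) hp0.ne',
      one_div]
    exact Real.rpow_le_rpow (hd0 l n) ((hdiffp l).le_tsum n fun m _ => hd0 l m)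
      (inv_nonneg.2 hp0.le)
  have hA : Tendsto (fun l => ∑' n : ↥(P (l + 1) \ P l), x (n : ℕ) ^ p) atTop (𝓝 0) := by
    refine tendsto_tsum_subtype_of_eventually_notMem hxp (fun n => Real.rpow_nonneg (hx n) p) _
      fun n _ => ?_
    by_cases hn : ∃ k, n ∈ P k
    · obtain ⟨k, hk⟩ := hn
      filter_upwards [eventually_ge_atTop k] with l hl h
      exact h.2 (hmono hl hk)
    · exact .of_forall fun l h => hn ⟨_, h.1⟩
  have hB0 : ∀ l, 0 ≤ ∑' n : ↥(P (l + 1) \ P l), xl l (n : ℕ) ^ p := fun l =>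
    tsum_nonneg fun n => Real.rpow_nonneg (hxl l n) p
  have hB : Tendsto (fun l => ∑' n : ↥(P (l + 1) \ P l), xl l (n : ℕ) ^ p) atTop (𝓝 0) := by
    have hlim := (hA.add hD).const_mul ((2 : ℝ) ^ (p - 1))
    rw [add_zero, mul_zero] at hlim
    refine squeeze_zero hB0 (fun l => ?_) hlim
    have hx' := hxp.subtype (P (l + 1) \ P l)
    have hd' := (hdiffp l).subtype (P (l + 1) \ P l)
    calc ∑' n : ↥(P (l + 1) \ P l), xl l (n : ℕ) ^ p
        ≤ ∑' n : ↥(P (l + 1) \ P l),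
            (2 : ℝ) ^ (p - 1) * (x (n : ℕ) ^ p + |x (n : ℕ) - xl l n| ^ p) := by
          refine ((hxlp l).subtype _).tsum_le_tsum (fun n => ?_) ((hx'.add hd').mul_left _)
          refine le_trans (Real.rpow_le_rpow (hxl l n) ?_ hp0.le)
            (mod_cast NNReal.rpow_add_le_mul_rpow_add_rpow ⟨x n, hx n⟩
              ⟨|x n - xl l n|, abs_nonneg _⟩ hp :
              (x n + |x n - xl l n|) ^ p ≤ 2 ^ (p - 1) * (x n ^ p + |x n - xl l n| ^ p))
          linarith [neg_abs_le (x n - xl l n)]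
      _ = (2 : ℝ) ^ (p - 1) * (∑' n : ↥(P (l + 1) \ P l), x (n : ℕ) ^ p +
            ∑' n : ↥(P (l + 1) \ P l), |x (n : ℕ) - xl l n| ^ p) := by
          rw [tsum_mul_left]
          congr 1
          exact hx'.tsum_add hd'
      _ ≤ _ := by
          gcongr
          exact (hdiffp l).tsum_subtype_le _ _ (hd0 l)
  have hG : Tendsto (fun l => g (∑' n : ↥(P (l + 1) \ P l), xl l (n : ℕ) ^ p)) atTop (𝓝 0) := by
    have h := (hg 0 Set.self_mem_Ici).tendsto
    rw [hg0] at h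
    exact h.comp (tendsto_nhdsWithin_iff.2 ⟨hB, .of_forall hB0⟩)
  refine tendsto_tsum_subtype_of_eventually_notMem hxp (fun n => Real.rpow_nonneg (hx n) p) _
    fun n hn => ?_
  have hmem : ∃ k, n ∈ P k := by
    by_contra! h
    have hxn : x n = 0 :=
      le_antisymm (le_of_tendsto_of_tendsto' (hpt n) hG fun l => hmark l n (h _)) (hx n)
    exact hn (by rw [hxn, Real.zero_rpow hp0.ne'])
  obtain ⟨k, hk⟩ := hmem
  filter_upwards [eventually_ge_atTop k] with l hl h
  exact h (hmono hl hk)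
end

section
/- Let D be a nonempty set, M ≥ 1 an integer, and a_0, a_1, …, a_M : D → ℝ satisfying the uniform ellipticity assumption Σ_{m=1}^M |a_m(x)| ≤ a_0(x) − r for all x ∈ D, with r > 0, and assume a_0 is bounded above on D with A := sup_{x∈D} a_0(x). Set a_min := inf_{x∈D} ( a_0(x) − Σ_{m=1}^M |a_m(x)| ) (so a_min ≥ r > 0) and α := 1 − a_min/A. Then 0 ≤ α < 1, and for every vector ρ = (ρ_1,…,ρ_M) with ρ_m > 1 for all m and (max_m ρ_m)·α < 1, the weighted uniform ellipticity estimate holds: sup_{x∈D} ( Σ_{m=1}^M ρ_m |a_m(x)| ) / a_0(x) ≤ (max_m ρ_m)·α < 1. -/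
/-- The uniform ellipticity assumption implies the weighted uniform ellipticity
estimate: with `α = 1 − a_min / sup_D a_0`, one has `0 ≤ α < 1` and, for any
weights `ρ_m > 1` with `(max_m ρ_m) · α < 1`,
`sup_{x∈D} (Σ_m ρ_m |a_m(x)|) / a_0(x) ≤ (max_m ρ_m) · α < 1`. -/
theorem weighted_uniform_ellipticity
    {D : Type*} [Nonempty D] (M : ℕ) (hM : 1 ≤ M)
    (a : ℕ → D → ℝ) (r : ℝ) (hr : 0 < r)
    (huea : ∀ x : D, ∑ m ∈ Finset.Icc 1 M, |a m x| ≤ a 0 x - r)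
    (hbdd : BddAbove (Set.range (a 0)))
    (A amin α : ℝ)
    (hA : A = ⨆ x : D, a 0 x)
    (hamin : amin = ⨅ x : D, (a 0 x - ∑ m ∈ Finset.Icc 1 M, |a m x|))
    (hα : α = 1 - amin / A) :
    (0 ≤ α ∧ α < 1) ∧
    ∀ ρ : ℕ → ℝ, (∀ m ∈ Finset.Icc 1 M, 1 < ρ m) →
      ∀ R : ℝ, (∃ m ∈ Finset.Icc 1 M, ρ m = R) → (∀ m ∈ Finset.Icc 1 M, ρ m ≤ R) →
        R * α < 1 →
        (⨆ x : D, (∑ m ∈ Finset.Icc 1 M, ρ m * |a m x|) / a 0 x) ≤ R * α := by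
  have hsum_nonneg (x : D) : 0 ≤ ∑ m ∈ Finset.Icc 1 M, |a m x| :=
    Finset.sum_nonneg fun m _ => abs_nonneg (a m x)
  have ha0_pos (x : D) : 0 < a 0 x := by linarith [huea x, hsum_nonneg x]
  have ha0_le (x : D) : a 0 x ≤ A := hA ▸ le_ciSup hbdd x
  have hamin_le (x : D) : amin ≤ a 0 x - ∑ m ∈ Finset.Icc 1 M, |a m x| := by
    rw [hamin]
    refine ciInf_le ⟨r, ?_⟩ x
    rintro _ ⟨y, rfl⟩
    linarith [huea y]
  have hr_le : r ≤ amin := by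
    rw [hamin]
    exact le_ciInf fun x => by linarith [huea x]
  have hamin_pos : 0 < amin := hr.trans_le hr_le
  obtain ⟨x₀⟩ := ‹Nonempty D›
  have hA_pos : 0 < A := (ha0_pos x₀).trans_le (ha0_le x₀)
  have hamin_le_A : amin ≤ A := by linarith [hamin_le x₀, hsum_nonneg x₀, ha0_le x₀]
  refine ⟨⟨?_, ?_⟩, ?_⟩
  · rw [hα, sub_nonneg]
    exact (div_le_one hA_pos).2 hamin_le_A
  · rw [hα]
    linarith [div_pos hamin_pos hA_pos]
  · rintro ρ hρ R ⟨k, hk, rfl⟩ hR -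
    have : Nonempty D := ⟨x₀⟩
    have hρk : 0 ≤ ρ k := by linarith [hρ k hk]
    refine ciSup_le fun x => ?_
    have hweighted : ∑ m ∈ Finset.Icc 1 M, ρ m * |a m x|
        ≤ ρ k * ∑ m ∈ Finset.Icc 1 M, |a m x| := by
      rw [Finset.mul_sum]
      exact Finset.sum_le_sum fun m hm => mul_le_mul_of_nonneg_right (hR m hm) (abs_nonneg _)
    have hsum_le : ∑ m ∈ Finset.Icc 1 M, |a m x| ≤ α * a 0 x := by
      have hdiv : amin / A * a 0 x ≤ amin := by
        rw [div_mul_eq_mul_div, div_le_iff₀ hA_pos]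
        exact mul_le_mul_of_nonneg_left (ha0_le x) hamin_pos.le
      rw [hα, sub_mul, one_mul]
      linarith [hamin_le x]
    rw [div_le_iff₀ (ha0_pos x), mul_assoc]
    exact hweighted.trans (mul_le_mul_of_nonneg_left hsum_le hρk)
end

section
/- Let M ≥ 1 and let (Λ_k)_{k∈ℕ₀} be a sequence of finite monotone subsets of ℕ^M with Λ_0 = {1}, such that for every k ∈ ℕ₀ there is a nonempty set S_k ⊆ R(Λ_k) with Λ_{k+1} = Λ_k ∪ S_k, and S_k contains at least one multi-index μ_k with ‖μ_k − 1‖₁ = min_{ν ∈ R(Λ_k)} ‖ν − 1‖₁. Then, setting b_k := min_{ν ∈ R(Λ_k)} ‖ν − 1‖₁, for every k ∈ ℕ₀ one has k + 1 ≤ Σ_{n=1}^{b_k} C(n + M − 1, n) < (b_k + 1)^M; in particular b_k + 1 > (k + 1)^{1/M}, i.e., the minimal margin norm b_k grows at least like the M-th root of the number of enrichment steps. -/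
/-- The `m`-th unit multi-index `e_m`. -/
def unitIdx (M : ℕ) (m : Fin M) : Fin M → ℕ := fun j => if j = m then 1 else 0

/-- A finite set `Λ ⊆ ℕ^M` of multi-indices (all entries `≥ 1`) is monotone
(downward closed) if `ν ∈ Λ` and `ν_m > 1` imply `ν − e_m ∈ Λ`. -/
def IsMonotoneIndexSet {M : ℕ} (Λ : Finset (Fin M → ℕ)) : Prop :=
  (∀ ν ∈ Λ, ∀ m, 1 ≤ ν m) ∧ ∀ ν ∈ Λ, ∀ m, 1 < ν m → ν - unitIdx M m ∈ Λ

/-- The reduced margin `R(Λ) = {ν ∈ ℕ^M \ Λ : ν − e_m ∈ Λ for all m with ν_m > 1}`. -/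
def redMargin {M : ℕ} (Λ : Finset (Fin M → ℕ)) : Set (Fin M → ℕ) :=
  {ν | (∀ m, 1 ≤ ν m) ∧ ν ∉ Λ ∧ ∀ m, 1 < ν m → ν - unitIdx M m ∈ Λ}

/-- `‖ν − 1‖₁ = Σ_m (ν_m − 1)` for a multi-index `ν`. -/
def nrmOne {M : ℕ} (ν : Fin M → ℕ) : ℕ := ∑ m, (ν m - 1)

open Finset in
/-- Stars and bars: the number of nonzero `f : Fin M → ℕ` of total mass at most `b`. -/
theorem card_filter_sum_mem_Icc (M b : ℕ) :
    #{f ∈ Fintype.piFinset fun _ : Fin M => range (b + 1) | ∑ m, f m ∈ Icc 1 b} =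
      ∑ n ∈ Icc 1 b, (n + M - 1).choose n := by
  rw [card_eq_sum_card_fiberwise (f := fun f : Fin M → ℕ => ∑ m, f m) (t := Icc 1 b)
    (by intro f hf; exact (mem_filter.1 hf).2)]
  refine sum_congr rfl fun n hn => ?_
  have hcard := Nat.card_congr (Sym.equivNatSumOfFintype (Fin M) n).symm
  rw [Nat.card_eq_fintype_card (α := Sym _ _), Sym.card_sym_eq_choose, Fintype.card_fin, add_comm M n] at hcard
  rw [← hcard]
  symm
  refine Nat.subtype_card _ fun f => ?_
  simp only [mem_filter, Fintype.mem_piFinset, mem_range]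
  refine ⟨fun h => h.2, fun h => ⟨⟨fun m => ?_, by rwa [h]⟩, h⟩⟩
  have hle := single_le_sum (f := f) (fun _ _ => Nat.zero_le _) (mem_univ m)
  rw [mem_Icc] at hn
  lia

open Finset in
theorem sum_Icc_choose_lt_pow (M b : ℕ) :
    ∑ n ∈ Icc 1 b, (n + M - 1).choose n < (b + 1) ^ M := by
  rw [← card_filter_sum_mem_Icc]
  have hbox : #(Fintype.piFinset fun _ : Fin M => range (b + 1)) = (b + 1) ^ M := by simp
  rw [← hbox]
  refine card_lt_card (filter_ssubset.2 ⟨0, by simp, by simp⟩)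

/-- Every multi-index outside `Λ` dominates, in norm, an element of the reduced margin. -/
theorem exists_mem_redMargin_nrmOne_le {M : ℕ} (Λ : Finset (Fin M → ℕ)) {ν : Fin M → ℕ}
    (hν : ∀ m, 1 ≤ ν m) (hνΛ : ν ∉ Λ) : ∃ ρ ∈ redMargin Λ, nrmOne ρ ≤ nrmOne ν := by
  induction h : nrmOne ν using Nat.strong_induction_on generalizing ν with
  | _ n ih =>
    by_cases hred : ∀ m, 1 < ν m → ν - unitIdx M m ∈ Λ
    · exact ⟨ν, ⟨hν, hνΛ, hred⟩, h.le⟩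
    · push Not at hred
      obtain ⟨m, hm, hmΛ⟩ := hred
      have hlt : nrmOne (ν - unitIdx M m) < n := by
        rw [← h]
        refine Finset.sum_lt_sum (fun j _ => ?_) ⟨m, Finset.mem_univ m, ?_⟩
        · simp only [Pi.sub_apply]
          lia
        · simp only [Pi.sub_apply, unitIdx, if_true]
          lia
      have hpos : ∀ j, 1 ≤ (ν - unitIdx M m) j := fun j => by
        have hj := hν j
        simp only [Pi.sub_apply, unitIdx]
        split_ifs with hjm
        · subst hjm
          lia
        · lia
      obtain ⟨ρ, hρ, hle⟩ := ih _ hlt hpos hmΛ rfl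
      exact ⟨ρ, hρ, hle.trans hlt.le⟩

theorem nrmOne_pos {M : ℕ} {ν : Fin M → ℕ} (hν : ∀ m, 1 ≤ ν m) (hne : ν ≠ fun _ => 1) :
    0 < nrmOne ν := by
  obtain ⟨m, hm⟩ := Function.ne_iff.1 hne
  refine Finset.sum_pos' (fun _ _ => Nat.zero_le _) ⟨m, Finset.mem_univ m, ?_⟩
  have := hν m
  lia

/-- If the adaptive algorithm starts from `Λ_0 = {1}` and at each step enriches
the monotone index set by a nonempty subset of the reduced margin containing a
multi-index of minimal norm `b_k = min_{ν ∈ R(Λ_k)} ‖ν−1‖₁`, then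
`k + 1 ≤ Σ_{n=1}^{b_k} C(n+M−1, n) < (b_k+1)^M`; in particular
`b_k + 1 > (k+1)^{1/M}`. -/
theorem minimal_margin_norm_growth
    (M : ℕ) (hM : 1 ≤ M)
    (Λ S : ℕ → Finset (Fin M → ℕ))
    (hΛ0 : Λ 0 = {fun _ => 1})
    (hmono : ∀ k, IsMonotoneIndexSet (Λ k))
    (hSne : ∀ k, (S k).Nonempty)
    (hSsub : ∀ k, ↑(S k) ⊆ redMargin (Λ k))
    (hstep : ∀ k, Λ (k + 1) = Λ k ∪ S k)
    (b : ℕ → ℕ)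
    (hb : ∀ k, b k = sInf (nrmOne '' redMargin (Λ k)))
    (hmin : ∀ k, ∃ μ ∈ S k, nrmOne μ = b k) :
    ∀ k : ℕ,
      k + 1 ≤ ∑ n ∈ Finset.Icc 1 (b k), (n + M - 1).choose n ∧
      ∑ n ∈ Finset.Icc 1 (b k), (n + M - 1).choose n < (b k + 1) ^ M ∧
      ((k : ℝ) + 1) ^ ((1 : ℝ) / M) < (b k : ℝ) + 1 := by
  intro k
  choose μ hμS hμb using hmin
  have hΛ : Monotone Λ := monotone_nat_of_le_succ fun n => by
    rw [hstep n]
    exact Finset.subset_union_left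
  have hμR : ∀ j, μ j ∈ redMargin (Λ j) := fun j => hSsub j (hμS j)
  have hμpos : ∀ j m, 1 ≤ μ j m := fun j => (hμR j).1
  have hμnot : ∀ i j, i ≤ j → μ j ∉ Λ i := fun i j hij h => (hμR j).2.1 (hΛ hij h)
  have hbmono : ∀ i j, i ≤ j → b i ≤ b j := fun i j hij => by
    obtain ⟨ρ, hρ, hle⟩ := exists_mem_redMargin_nrmOne_le (Λ i) (hμpos j) (hμnot i j hij)
    rw [hb i, ← hμb j]
    exact (Nat.sInf_le (Set.mem_image_of_mem _ hρ)).trans hle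
  have hbpos : ∀ j, 0 < b j := fun j => by
    rw [← hμb j]
    refine nrmOne_pos (hμpos j) fun h => hμnot 0 j j.zero_le ?_
    rw [hΛ0, h]
    exact Finset.mem_singleton_self _
  have hμne : ∀ i j, i < j → μ i ≠ μ j := fun i j hij h => by
    refine hμnot (i + 1) j hij ?_
    rw [hstep i, ← h]
    exact Finset.mem_union_right _ (hμS i)
  have hμinj : Function.Injective μ := fun i j h => by
    by_contra hij
    rcases lt_or_gt_of_ne hij with hlt | hlt
    · exact hμne i j hlt h
    · exact hμne j i hlt h.symm
  have hcount : k + 1 ≤ ∑ n ∈ Finset.Icc 1 (b k), (n + M - 1).choose n := by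
    rw [← card_filter_sum_mem_Icc]
    conv_lhs => rw [← Finset.card_range (k + 1)]
    refine Finset.card_le_card_of_injOn (fun j m => μ j m - 1) (fun j hj => ?_)
      fun i _ j _ hij => hμinj (funext fun m => ?_)
    · have hjk : b j ≤ b k := hbmono j k (by simpa [Nat.lt_succ_iff] using hj)
      have hsum : ∑ m, (μ j m - 1) = b j := hμb j
      simp only [Finset.coe_filter, Set.mem_ofPred_eq, Fintype.mem_piFinset, Finset.mem_range,
        Finset.mem_Icc, hsum]
      refine ⟨fun m => ?_, hbpos j, hjk⟩
      have hle := Finset.single_le_sum (f := fun m => μ j m - 1) (fun _ _ => Nat.zero_le _)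
        (Finset.mem_univ m)
      simp only [hsum] at hle
      lia
    · have hm : μ i m - 1 = μ j m - 1 := congrFun hij m
      have hi := hμpos i m
      have hj := hμpos j m
      lia
  have hpow := sum_Icc_choose_lt_pow M (b k)
  refine ⟨hcount, hpow, ?_⟩
  have hlt : ((k : ℝ) + 1) < ((b k : ℝ) + 1) ^ M := by exact_mod_cast hcount.trans_lt hpow
  have hM0 : (0 : ℝ) < M := by exact_mod_cast hM
  rw [one_div, Real.rpow_inv_lt_iff_of_pos (by positivity) (by positivity) hM0, Real.rpow_natCast]
  exact hlt
end
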